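/- For any circular matrix A of order m×n without dominating rows and any α ∈ ℕ, the polyhedron Q*(A, α·1) is completely described by the inequalities x ≥ 0 and Ax ≥ α·1 together with the Γ-inequalities over all simple directed circuits Γ in D(A) containing no reverse row arcs, with p(Γ) ≥ 2 and such that p(Γ) does not divide t(Γ, α·1). -/

import Mathlib

namespace CircCover

attribute [local instance] Classical.propDecidable

/-- Membership in the circular interval `[a, a + k)ₙ` of `ZMod n`. -/
def inInterval {n : ℕ} (a : ZMod n) (k : ℕ) (j : ZMod n) : Prop :=
  ∃ s : ℕ, s < k ∧ j = a + (s : ZMod n)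

/-- The `{0,1}`-matrix whose `i`-th row is the incidence vector of `[ℓ i, ℓ i + k i)ₙ`. -/
noncomputable def circMatrix {m n : ℕ} (ℓ : Fin m → ZMod n) (k : Fin m → ℕ) :
    Matrix (Fin m) (ZMod n) ℝ :=
  fun i j => if inInterval (ℓ i) (k i) j then 1 else 0

/-- The condition `2 ≤ kᵢ ≤ n - 1` making `circMatrix ℓ k` a circular matrix. -/
def circBounds (n : ℕ) {m : ℕ} (k : Fin m → ℕ) : Prop :=
  ∀ i, 2 ≤ k i ∧ k i ≤ n - 1

/-- Arcs of the digraph `D(A)` associated with a circular matrix. -/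
inductive Arc (m n : ℕ) : Type
  | fwdRow (i : Fin m)
  | fwdShort (j : ZMod n)
  | revRow (i : Fin m)
  | revShort (j : ZMod n)
  deriving DecidableEq

namespace Arc

variable {m n : ℕ} (ℓ : Fin m → ZMod n) (k : Fin m → ℕ)

/-- The tail of an arc of `D(A)`. -/
def tail : Arc m n → ZMod n
  | fwdRow i => ℓ i - 1
  | fwdShort j => j - 1
  | revRow i => ℓ i + (k i : ZMod n) - 1
  | revShort j => j

/-- The head of an arc of `D(A)`. -/
def head : Arc m n → ZMod n
  | fwdRow i => ℓ i + (k i : ZMod n) - 1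
  | fwdShort j => j
  | revRow i => ℓ i - 1
  | revShort j => j - 1

/-- The oriented length of an arc of `D(A)`. -/
def len (k : Fin m → ℕ) : Arc m n → ℤ
  | fwdRow i => (k i : ℤ)
  | fwdShort _ => 1
  | revRow i => -(k i : ℤ)
  | revShort _ => -1

/-- Forward arcs. -/
def IsForward : Arc m n → Prop
  | fwdRow _ => True
  | fwdShort _ => True
  | _ => False

/-- Forward row arcs. -/
def IsFwdRow : Arc m n → Prop
  | fwdRow _ => True
  | _ => False

/-- Reverse row arcs. -/
def IsRevRow : Arc m n → Prop
  | revRow _ => True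
  | _ => False

/-- Forward short arcs. -/
def IsFwdShort : Arc m n → Prop
  | fwdShort _ => True
  | _ => False

/-- The arc jumps over node `j`. -/
def Jumps : Arc m n → ZMod n → Prop
  | fwdRow i, j => inInterval (ℓ i) (k i) j
  | fwdShort j', j => j' = j
  | revRow i, j => inInterval (ℓ i) (k i) j
  | revShort j', j => j' = j

end Arc

variable {m n : ℕ}

/-- A (not necessarily simple) closed directed path in `D(A)`, given as its list of arcs. -/
def IsClosedWalk (ℓ : Fin m → ZMod n) (k : Fin m → ℕ) (γ : List (Arc m n)) : Prop :=
  ∃ h : γ ≠ [],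
    List.Chain' (fun a b => Arc.head ℓ k a = Arc.tail ℓ k b) γ ∧
      Arc.head ℓ k (γ.getLast h) = Arc.tail ℓ k (γ.head h)

/-- A simple directed circuit in `D(A)`: a closed directed path visiting pairwise
distinct nodes. -/
def IsCircuit (ℓ : Fin m → ZMod n) (k : Fin m → ℕ) (γ : List (Arc m n)) : Prop :=
  IsClosedWalk ℓ k γ ∧ (γ.map (Arc.tail ℓ k)).Nodup

/-- The sum of the oriented lengths of the arcs of `γ`; it equals `p(γ) * n` where `p(γ)`
is the winding number. -/
def windingSum (k : Fin m → ℕ) (γ : List (Arc m n)) : ℤ :=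
  (γ.map (Arc.len k)).sum

/-- `p⁺(γ, j)`: the number of forward arcs of `γ` jumping over `j`. -/
noncomputable def pPlus (ℓ : Fin m → ZMod n) (k : Fin m → ℕ) (γ : List (Arc m n))
    (j : ZMod n) : ℕ :=
  γ.countP fun a => decide (Arc.IsForward a ∧ Arc.Jumps ℓ k a j)

/-- `p⁻(γ, j)`: the number of reverse arcs of `γ` jumping over `j`. -/
noncomputable def pMinus (ℓ : Fin m → ZMod n) (k : Fin m → ℕ) (γ : List (Arc m n))
    (j : ZMod n) : ℕ :=
  γ.countP fun a => decide (¬ Arc.IsForward a ∧ Arc.Jumps ℓ k a j)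

/-- The number of (forward) row arcs of `γ` jumping over `j`. -/
noncomputable def rowJumpCount (ℓ : Fin m → ZMod n) (k : Fin m → ℕ) (γ : List (Arc m n))
    (j : ZMod n) : ℕ :=
  γ.countP fun a => decide (Arc.IsFwdRow a ∧ Arc.Jumps ℓ k a j)

/-- The number of forward row arcs of `γ`. -/
def numRowArcs (γ : List (Arc m n)) : ℕ :=
  γ.countP fun a => match a with | Arc.fwdRow _ => true | _ => false

/-- `t(γ, b) = ∑_{aᵢ ∈ γ} bᵢ - ∑_{āᵢ ∈ γ} bᵢ`. -/
def tVal (b : Fin m → ℤ) (γ : List (Arc m n)) : ℤ :=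
  (γ.map fun a => match a with
    | Arc.fwdRow i => b i
    | Arc.revRow i => -(b i)
    | _ => 0).sum

/-- `t⁻(γ, b) = ∑_{āᵢ ∈ γ} bᵢ`. -/
def tMinusVal (b : Fin m → ℤ) (γ : List (Arc m n)) : ℤ :=
  (γ.map fun a => match a with
    | Arc.revRow i => b i
    | _ => 0).sum

/-- `β(γ, b) = ⌊t(γ, b) / p⌋`. -/
def betaVal (b : Fin m → ℤ) (γ : List (Arc m n)) (p : ℤ) : ℤ :=
  Int.fdiv (tVal b γ) p

/-- `r(γ, b) = t(γ, b) - β(γ, b) * p`. -/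
def rVal (b : Fin m → ℤ) (γ : List (Arc m n)) (p : ℤ) : ℤ :=
  tVal b γ - betaVal b γ p * p

/-- The `γ`-inequality `∑ⱼ (p⁻(γ,j) + r) xⱼ ≥ r (β + 1) + ∑_{āᵢ ∈ γ} bᵢ`. -/
def GammaIneqHolds [NeZero n] (ℓ : Fin m → ZMod n) (k : Fin m → ℕ) (b : Fin m → ℤ)
    (γ : List (Arc m n)) (p : ℤ) (x : ZMod n → ℝ) : Prop :=
  ∑ j : ZMod n, ((pMinus ℓ k γ j : ℝ) + (rVal b γ p : ℝ)) * x j ≥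
    (rVal b γ p : ℝ) * ((betaVal b γ p : ℝ) + 1) + (tMinusVal b γ : ℝ)

/-- The fractional covering polyhedron `Q(A, b) = {x ≥ 0 : A x ≥ b}`. -/
def Qpoly [NeZero n] (A : Matrix (Fin m) (ZMod n) ℝ) (b : Fin m → ℝ) :
    Set (ZMod n → ℝ) :=
  {x | (∀ j, 0 ≤ x j) ∧ ∀ i, b i ≤ ∑ j : ZMod n, A i j * x j}

/-- A point of `ℝⁿ` all whose coordinates are integers. -/
def IsIntegerPoint {n : ℕ} (x : ZMod n → ℝ) : Prop :=
  ∀ j, ∃ z : ℤ, x j = (z : ℝ)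

/-- The covering polyhedron `Q*(A, b) = conv{x ∈ ℤⁿ : x ≥ 0, A x ≥ b}`. -/
noncomputable def Qstar [NeZero n] (A : Matrix (Fin m) (ZMod n) ℝ) (b : Fin m → ℝ) :
    Set (ZMod n → ℝ) :=
  convexHull ℝ {x | IsIntegerPoint x ∧ x ∈ Qpoly A b}

/-- The slack of row `i` of `A` at the point `x`. -/
noncomputable def rowSlack [NeZero n] (ℓ : Fin m → ZMod n) (k : Fin m → ℕ)
    (b : Fin m → ℤ) (x : ZMod n → ℝ) (i : Fin m) : ℝ :=
  (∑ j : ZMod n, circMatrix ℓ k i j * x j) - (b i : ℝ)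

/-- `μ = ⌈1ᵀ x⌉ - 1ᵀ x`. -/
noncomputable def muVal [NeZero n] (x : ZMod n → ℝ) : ℝ :=
  (⌈∑ j : ZMod n, x j⌉ : ℝ) - ∑ j : ZMod n, x j

/-- Entry `i` of the last column `v` of `Ã` (the column indexed by `n ≡ 0`). -/
noncomputable def vRow (ℓ : Fin m → ZMod n) (k : Fin m → ℕ) (i : Fin m) : ℝ :=
  circMatrix ℓ k i 0

/-- Entry `m + j` of the last column `v` of `Ã`. -/
noncomputable def vShort (j : ZMod n) : ℝ :=
  if j = 0 then 1 else 0

/-- The cost of an arc in the weighted digraph `D(A, x)`: forward arcs carry the cost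
`c⁺ = μ (s* - (1 - μ) v)` and reverse arcs the cost `c⁻ = (1 - μ)(s* + μ v)`. -/
noncomputable def arcCost [NeZero n] (ℓ : Fin m → ZMod n) (k : Fin m → ℕ)
    (b : Fin m → ℤ) (x : ZMod n → ℝ) : Arc m n → ℝ
  | Arc.fwdRow i => muVal x * (rowSlack ℓ k b x i - (1 - muVal x) * vRow ℓ k i)
  | Arc.fwdShort j => muVal x * (x j - (1 - muVal x) * vShort j)
  | Arc.revRow i => (1 - muVal x) * (rowSlack ℓ k b x i + muVal x * vRow ℓ k i)
  | Arc.revShort j => (1 - muVal x) * (x j + muVal x * vShort j)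

/-- The cost `c(γ, x)` of a walk `γ` in `D(A, x)`. -/
noncomputable def walkCost [NeZero n] (ℓ : Fin m → ZMod n) (k : Fin m → ℕ)
    (b : Fin m → ℤ) (x : ZMod n → ℝ) (γ : List (Arc m n)) : ℝ :=
  (γ.map (arcCost ℓ k b x)).sum

/-- Row `i` dominates row `i'` of `A`. -/
def Dominates (A : Matrix (Fin m) (ZMod n) ℝ) (i i' : Fin m) : Prop :=
  i ≠ i' ∧ ∀ j, A i' j ≤ A i j

/-- `A` has no dominating rows. -/
def NoDominatingRows (A : Matrix (Fin m) (ZMod n) ℝ) : Prop :=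
  ∀ i i', ¬ Dominates A i i'

/-- The affine dimension of a subset of `ℝⁿ` (`-1` for the empty set). -/
noncomputable def adim [NeZero n] (S : Set (ZMod n → ℝ)) : ℤ :=
  if S = ∅ then -1 else (Module.finrank ℝ (affineSpan ℝ S).direction : ℤ)

/-- The valid inequality `aᵀ x ≥ α₀` defines a facet of `P`:
the face it defines has affine dimension `dim P - 1`. -/
def IsFacetIneq [NeZero n] (P : Set (ZMod n → ℝ)) (a : ZMod n → ℝ) (α₀ : ℝ) : Prop :=
  (∀ x ∈ P, α₀ ≤ ∑ j : ZMod n, a j * x j) ∧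
    adim {x ∈ P | ∑ j : ZMod n, a j * x j = α₀} = adim P - 1

/-- `j` is a node of the walk `γ`. -/
def IsNodeOf (ℓ : Fin m → ZMod n) (k : Fin m → ℕ) (γ : List (Arc m n)) (j : ZMod n) : Prop :=
  ∃ a ∈ γ, Arc.tail ℓ k a = j

/-- `j` is an essential bullet of `γ`: a node of `γ` which is neither a circle
(head of a forward short arc of `γ`) nor a cross (tail of a reverse short arc of `γ`). -/
def IsEssentialBullet (ℓ : Fin m → ZMod n) (k : Fin m → ℕ) (γ : List (Arc m n))
    (j : ZMod n) : Prop :=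
  IsNodeOf ℓ k γ j ∧ Arc.fwdShort j ∉ γ ∧ Arc.revShort j ∉ γ

/-- The number of essential bullets of `γ`. -/
noncomputable def numEssentialBullets [NeZero n] (ℓ : Fin m → ZMod n) (k : Fin m → ℕ)
    (γ : List (Arc m n)) : ℕ :=
  (Finset.univ.filter fun j : ZMod n => IsEssentialBullet ℓ k γ j).card

/-- `∑_{i ∈ F} a_{ij}`, the number of rows of `F` whose interval contains `j`. -/
noncomputable def rowCount (ℓ : Fin m → ZMod n) (k : Fin m → ℕ) (F : Finset (Fin m))
    (j : ZMod n) : ℕ :=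
  (F.filter fun i => inInterval (ℓ i) (k i) j).card

/-- The row family inequality induced by `F` (with `p* = max_j ∑_{i ∈ F} a_{ij} - 1`). -/
def RowFamilyIneqHolds [NeZero n] (ℓ : Fin m → ZMod n) (k : Fin m → ℕ)
    (F : Finset (Fin m)) (x : ZMod n → ℝ) : Prop :=
  let s := F.card
  let pstar := (Finset.univ.sup fun j : ZMod n => rowCount ℓ k F j) - 1
  let rstar := s - pstar * (s / pstar)
  ((rstar : ℝ) + 1) * ∑ j ∈ Finset.univ.filter (fun j : ZMod n => rowCount ℓ k F j = pstar + 1), x j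
    + (rstar : ℝ) * ∑ j ∈ Finset.univ.filter (fun j : ZMod n => rowCount ℓ k F j ≤ pstar), x j
    ≥ (rstar : ℝ) * (((s + pstar - 1) / pstar : ℕ) : ℝ)


section Rounding

open MeasureTheory

lemma integrable_fract_add (c : ℝ) :
    Integrable (fun θ : ℝ => Int.fract (c + θ)) (volume.restrict (Set.Ioc (0 : ℝ) 1)) := by
  refine Integrable.of_bound (C := 1) ?_ ?_
  · exact (measurable_fract.comp (measurable_const.add measurable_id)).aestronglyMeasurable
  · refine Filter.Eventually.of_forall fun θ => ?_
    rw [Real.norm_eq_abs, abs_of_nonneg (Int.fract_nonneg _)]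
    exact (Int.fract_lt_one _).le

lemma integral_fract_add (c : ℝ) :
    ∫ θ in Set.Ioc (0 : ℝ) 1, Int.fract (c + θ) = ∫ θ in (0 : ℝ)..1, Int.fract θ := by
  have hper : Function.Periodic (fun t : ℝ => Int.fract t) 1 := fun t => Int.fract_add_one t
  rw [← intervalIntegral.integral_of_le zero_le_one,
    intervalIntegral.integral_comp_add_left (fun t => Int.fract t) c]
  have := hper.intervalIntegral_add_eq c 0
  simpa using this

lemma integrable_floor_add_sub (a b : ℝ) :
    Integrable (fun θ : ℝ => (⌊a + θ⌋ : ℝ) - (⌊b + θ⌋ : ℝ))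
      (volume.restrict (Set.Ioc (0 : ℝ) 1)) := by
  have h : (fun θ : ℝ => (⌊a + θ⌋ : ℝ) - (⌊b + θ⌋ : ℝ)) =
      fun θ => (a - b) - (Int.fract (a + θ) - Int.fract (b + θ)) := by
    funext θ
    simp only [Int.fract]
    ring
  rw [h]
  exact (integrable_const _).sub ((integrable_fract_add a).sub (integrable_fract_add b))

lemma integral_floor_add_sub (a b : ℝ) :
    ∫ θ in Set.Ioc (0 : ℝ) 1, ((⌊a + θ⌋ : ℝ) - (⌊b + θ⌋ : ℝ)) = a - b := by
  have h : (fun θ : ℝ => (⌊a + θ⌋ : ℝ) - (⌊b + θ⌋ : ℝ)) =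
      fun θ => (a - b) - (Int.fract (a + θ) - Int.fract (b + θ)) := by
    funext θ
    simp only [Int.fract]
    ring
  have hsub : Integrable (fun θ : ℝ => Int.fract (a + θ) - Int.fract (b + θ))
      (volume.restrict (Set.Ioc (0 : ℝ) 1)) :=
    (integrable_fract_add a).sub (integrable_fract_add b)
  rw [h, integral_sub (integrable_const _) hsub, integral_sub (integrable_fract_add a) (integrable_fract_add b),
    integral_fract_add, integral_fract_add]
  simp

end Rounding

/-- The sum of `x` over the support of a row of a circular matrix. -/
lemma circMatrix_row_sum [NeZero n] (ℓ : Fin m → ZMod n) (k : Fin m → ℕ) (i : Fin m)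
    (hk : k i ≤ n) (f : ZMod n → ℝ) :
    ∑ j : ZMod n, circMatrix ℓ k i j * f j = ∑ s ∈ Finset.range (k i), f (ℓ i + s) := by
  have hinj : Set.InjOn (fun s : ℕ => ℓ i + (s : ZMod n)) (Finset.range (k i)) := by
    intro s hs t ht hst
    simp only [Finset.coe_range, Set.mem_Iio] at hs ht
    have h := add_left_cancel hst
    have h2 := congrArg ZMod.val h
    rwa [ZMod.val_natCast, ZMod.val_natCast, Nat.mod_eq_of_lt (by omega),
      Nat.mod_eq_of_lt (by omega)] at h2
  rw [← Finset.sum_image (f := f) (g := fun s : ℕ => ℓ i + (s : ZMod n)) hinj]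
  simp only [circMatrix, ite_mul, one_mul, zero_mul]
  rw [← Finset.sum_filter]
  refine Finset.sum_congr ?_ fun _ _ => rfl
  ext j
  rw [Finset.mem_filter]
  simp only [inInterval, Finset.mem_univ, true_and, Finset.mem_image, Finset.mem_range]
  exact exists_congr fun s => and_congr_right fun _ => eq_comm

/-- A vector on `ZMod n` is, up to its mean, the difference of a potential. -/
lemma exists_potential [NeZero n] (x : ZMod n → ℝ) :
    ∃ ξ : ZMod n → ℝ, ∀ j, x j = ξ j - ξ (j - 1) + (∑ i, x i) / n := by
  set y := ∑ i, x i with hy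
  have hn : (n : ℝ) ≠ 0 := Nat.cast_ne_zero.2 (NeZero.ne n)
  have htot : ∑ s ∈ Finset.range n, (x (s : ZMod n) - y / n) = 0 := by
    have h1 : ∑ s ∈ Finset.range n, x (s : ZMod n) = y := by
      rw [hy]
      refine Finset.sum_nbij' (fun s : ℕ => (s : ZMod n)) ZMod.val ?_ ?_ ?_ ?_ ?_
      · simp
      · intro j _
        simpa using ZMod.val_lt j
      · intro s hs
        rw [ZMod.val_natCast, Nat.mod_eq_of_lt (Finset.mem_range.1 hs)]
      · intro j _
        exact ZMod.natCast_zmod_val j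
      · intro s _
        rfl
    rw [Finset.sum_sub_distrib, h1]
    simp only [Finset.sum_const, Finset.card_range, nsmul_eq_mul]
    field_simp
    ring
  refine ⟨fun j => ∑ s ∈ Finset.range (j.val + 1), (x (s : ZMod n) - y / n), fun j => ?_⟩
  by_cases hj : j.val = 0
  · have hj0 : j = 0 := (ZMod.val_eq_zero j).1 hj
    have hlast : ((0 : ZMod n) - 1).val + 1 = n := by
      obtain ⟨N, rfl⟩ := Nat.exists_eq_succ_of_ne_zero (NeZero.ne n)
      rw [zero_sub, Nat.succ_eq_add_one, ZMod.val_neg_one]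
    subst hj0
    beta_reduce
    rw [hlast, htot]
    simp
  · obtain ⟨s, hs⟩ := Nat.exists_eq_succ_of_ne_zero hj
    have hjs : j - 1 = (s : ZMod n) := by
      rw [← ZMod.natCast_zmod_val j, hs]
      push_cast
      ring
    have hval : (j - 1).val = s := by
      rw [hjs, ZMod.val_natCast, Nat.mod_eq_of_lt]
      have := ZMod.val_lt j
      omega
    beta_reduce
    rw [hval, hs, Finset.sum_range_succ _ (s + 1)]
    have : ((s + 1 : ℕ) : ZMod n) = j := by
      rw [← Nat.succ_eq_add_one, ← hs, ZMod.natCast_zmod_val]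
    rw [this]
    ring

lemma Qpoly_slice_subset_Qstar [NeZero n] (ℓ : Fin m → ZMod n) (k : Fin m → ℕ)
    (hk : ∀ i, k i ≤ n) (b : Fin m → ℤ) (x : ZMod n → ℝ)
    (hx : x ∈ Qpoly (circMatrix ℓ k) (fun i => (b i : ℝ))) (y : ℤ)
    (hy : ∑ j, x j = (y : ℝ)) :
    x ∈ Qstar (circMatrix ℓ k) (fun i => (b i : ℝ)) := by
  have hn : (n : ℝ) ≠ 0 := Nat.cast_ne_zero.2 (NeZero.ne n)
  obtain ⟨ξ, hξ⟩ := exists_potential x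
  rw [hy] at hξ
  set X : ℕ → ℝ := fun s => ξ ((s : ZMod n) - 1) + y * s / n with hX
  have hXs : ∀ s : ℕ, X (s + 1) = X s + x (s : ZMod n) := by
    intro s
    simp only [hX]
    rw [hξ s]
    push_cast
    rw [add_sub_cancel_right]
    ring
  have hXn : ∀ s q : ℕ, X (s + n * q) = X s + ((q * y : ℤ) : ℝ) := by
    intro s q
    simp only [hX]
    push_cast
    rw [ZMod.natCast_self, zero_mul, add_zero]
    field_simp
    ring
  set R : ℝ → ZMod n → ℤ := fun θ j => ⌊X (j.val + 1) + θ⌋ - ⌊X j.val + θ⌋ with hR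
  have hRs : ∀ θ (s : ℕ), R θ (s : ZMod n) = ⌊X (s + 1) + θ⌋ - ⌊X s + θ⌋ := by
    intro θ s
    simp only [hR, ZMod.val_natCast]
    conv_rhs => rw [← Nat.mod_add_div s n]
    rw [show s % n + n * (s / n) + 1 = (s % n + 1) + n * (s / n) by ring, hXn, hXn,
      add_right_comm (X (s % n + 1)), add_right_comm (X (s % n)), Int.floor_add_intCast, Int.floor_add_intCast]
    ring
  have htele : ∀ θ (a c : ℕ), ∑ s ∈ Finset.range c, (R θ ((a + s : ℕ) : ZMod n) : ℝ) =
      ((⌊X (a + c) + θ⌋ - ⌊X a + θ⌋ : ℤ) : ℝ) := by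
    intro θ a c
    induction c with
    | zero => simp
    | succ c ih =>
      rw [Finset.sum_range_succ, ih, hRs, ← add_assoc]
      push_cast
      ring
  have hXtele : ∀ (a c : ℕ), ∑ s ∈ Finset.range c, x ((a + s : ℕ) : ZMod n) =
      X (a + c) - X a := by
    intro a c
    induction c with
    | zero => simp
    | succ c ih =>
      rw [Finset.sum_range_succ, ih, ← add_assoc, hXs]
      ring
  have hRnonneg : ∀ θ j, 0 ≤ R θ j := by
    intro θ j
    simp only [hR, sub_nonneg]
    refine Int.floor_le_floor ?_
    rw [hXs, ZMod.natCast_zmod_val]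
    linarith [hx.1 j]
  have hRle : ∀ θ j, R θ j ≤ ⌈x j⌉ + 1 := by
    intro θ j
    have h1 := Int.floor_le (X (j.val + 1) + θ)
    have h2 := Int.lt_floor_add_one (X j.val + θ)
    rw [hXs, ZMod.natCast_zmod_val] at h1
    have h3 := Int.le_ceil (x j)
    have : ((R θ j : ℤ) : ℝ) ≤ ((⌈x j⌉ + 1 : ℤ) : ℝ) := by
      simp only [hR]
      rw [hXs, ZMod.natCast_zmod_val]
      push_cast
      linarith
    exact_mod_cast this
  set S : Set (ZMod n → ℝ) := (fun (w : ZMod n → ℤ) j => (w j : ℝ)) ''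
    (Set.Icc (0 : ZMod n → ℤ) (fun j => ⌈x j⌉ + 1)) with hS
  have hSfin : S.Finite := (Set.finite_Icc _ _).image _
  set T : Set (ZMod n → ℝ) := S ∩ {z | IsIntegerPoint z ∧
    z ∈ Qpoly (circMatrix ℓ k) (fun i => (b i : ℝ))} with hT
  have hTfin : T.Finite := hSfin.inter_of_left _
  have hmem : ∀ θ, (fun j => (R θ j : ℝ)) ∈ T := by
    intro θ
    refine ⟨⟨R θ, ⟨fun j => hRnonneg θ j, fun j => hRle θ j⟩, rfl⟩, fun j => ⟨R θ j, rfl⟩,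
      fun j => Int.cast_nonneg (hRnonneg θ j), fun i => ?_⟩
    have hrow := hx.2 i
    rw [circMatrix_row_sum ℓ k i (hk i)] at hrow ⊢
    have hcast : ∀ s : ℕ, ℓ i + (s : ZMod n) = (((ℓ i).val + s : ℕ) : ZMod n) := by
      intro s
      push_cast
      rw [ZMod.natCast_zmod_val]
    simp only [hcast] at hrow ⊢
    rw [hXtele] at hrow
    rw [htele]
    have hfl : ⌊X (ℓ i).val + θ⌋ + b i ≤ ⌊X ((ℓ i).val + k i) + θ⌋ := by
      rw [← Int.floor_add_intCast]
      exact Int.floor_le_floor (by linarith)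
    exact_mod_cast (by omega : b i ≤ ⌊X ((ℓ i).val + k i) + θ⌋ - ⌊X (ℓ i).val + θ⌋)
  have hintegral : ∀ j, MeasureTheory.Integrable (fun θ : ℝ => (R θ j : ℝ))
      (MeasureTheory.volume.restrict (Set.Ioc (0 : ℝ) 1)) := by
    intro j
    simp only [hR, Int.cast_sub]
    exact integrable_floor_add_sub _ _
  have : MeasureTheory.IsProbabilityMeasure
      (MeasureTheory.volume.restrict (Set.Ioc (0 : ℝ) 1)) := ⟨by simp⟩
  have key := (convex_convexHull ℝ T).integral_mem (hTfin.isClosed_convexHull ℝ)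
    (μ := MeasureTheory.volume.restrict (Set.Ioc (0 : ℝ) 1))
    (f := fun θ j => (R θ j : ℝ))
    (Filter.Eventually.of_forall fun θ => subset_convexHull ℝ T (hmem θ))
    (MeasureTheory.Integrable.of_eval hintegral)
  have heq : (∫ θ in Set.Ioc (0 : ℝ) 1, fun j => (R θ j : ℝ)) = x := by
    funext j
    rw [MeasureTheory.eval_integral hintegral]
    simp only [hR, Int.cast_sub]
    rw [integral_floor_add_sub, hXs, ZMod.natCast_zmod_val]
    ring
  rw [heq] at key
  exact convexHull_mono Set.inter_subset_right key

/-- `γ` is the list of arcs of a directed path of `D(A)` from `u` to `v`. -/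
def IsWalk (ℓ : Fin m → ZMod n) (k : Fin m → ℕ) : ZMod n → List (Arc m n) → ZMod n → Prop
  | u, [], v => u = v
  | u, a :: γ, v => Arc.tail ℓ k a = u ∧ IsWalk ℓ k (Arc.head ℓ k a) γ v

section Walks

variable (ℓ : Fin m → ZMod n) (k : Fin m → ℕ)

lemma isWalk_append (γ₁ γ₂ : List (Arc m n)) (u v : ZMod n) :
    IsWalk ℓ k u (γ₁ ++ γ₂) v ↔ ∃ w, IsWalk ℓ k u γ₁ w ∧ IsWalk ℓ k w γ₂ v := by
  induction γ₁ generalizing u with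
  | nil => simp [IsWalk]
  | cons a γ ih => simp [IsWalk, ih, and_assoc]

lemma isChain_cons_and_head_getLast_iff (a : Arc m n) (γ : List (Arc m n)) (v : ZMod n) :
    (List.IsChain (fun a b => Arc.head ℓ k a = Arc.tail ℓ k b) (a :: γ) ∧
      Arc.head ℓ k ((a :: γ).getLast (List.cons_ne_nil _ _)) = v) ↔
    IsWalk ℓ k (Arc.head ℓ k a) γ v := by
  induction γ generalizing a with
  | nil => simp [IsWalk]
  | cons c γ ih =>
    rw [List.isChain_cons_cons, List.getLast_cons_cons, and_assoc, ih]
    exact and_congr_left fun _ => eq_comm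

lemma isClosedWalk_iff (γ : List (Arc m n)) :
    IsClosedWalk ℓ k γ ↔ γ ≠ [] ∧ ∃ u, IsWalk ℓ k u γ u := by
  cases γ with
  | nil => simp [IsClosedWalk]
  | cons a γ =>
    have h := isChain_cons_and_head_getLast_iff ℓ k a γ (Arc.tail ℓ k a)
    constructor
    · rintro ⟨_, h1, h2⟩
      exact ⟨List.cons_ne_nil _ _, Arc.tail ℓ k a, rfl, h.1 ⟨h1, h2⟩⟩
    · rintro ⟨hne, u, rfl, hw⟩
      obtain ⟨h1, h2⟩ := h.2 hw
      exact ⟨hne, h1, h2⟩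

lemma Arc.len_cast (a : Arc m n) :
    ((Arc.len k a : ℤ) : ZMod n) = Arc.head ℓ k a - Arc.tail ℓ k a := by
  cases a <;> simp [Arc.len, Arc.head, Arc.tail]

variable {ℓ k}

lemma IsWalk.windingSum_cast {γ : List (Arc m n)} {u v : ZMod n} (h : IsWalk ℓ k u γ v) :
    ((windingSum k γ : ℤ) : ZMod n) = v - u := by
  induction γ generalizing u with
  | nil =>
    obtain rfl : u = v := h
    simp [windingSum]
  | cons a γ ih =>
    obtain ⟨rfl, h⟩ := h
    have := ih h
    simp only [windingSum, List.map_cons, List.sum_cons, Int.cast_add] at this ⊢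
    rw [this, Arc.len_cast ℓ k]
    ring

lemma IsWalk.exists_windingNumber {γ : List (Arc m n)} {u : ZMod n} (h : IsWalk ℓ k u γ u) :
    ∃ p : ℤ, p * (n : ℤ) = windingSum k γ := by
  have h1 := h.windingSum_cast
  rw [sub_self, ZMod.intCast_zmod_eq_zero_iff_dvd] at h1
  obtain ⟨p, hp⟩ := h1
  exact ⟨p, by rw [hp, mul_comm]⟩

lemma windingSum_append (γ₁ γ₂ : List (Arc m n)) :
    windingSum k (γ₁ ++ γ₂) = windingSum k γ₁ + windingSum k γ₂ := by
  simp [windingSum]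

lemma tVal_append (b : Fin m → ℤ) (γ₁ γ₂ : List (Arc m n)) :
    tVal b (γ₁ ++ γ₂) = tVal b γ₁ + tVal b γ₂ := by
  simp [tVal]

/-- A walk visiting a node twice contains a closed walk which can be cut out. -/
lemma exists_duplicate_split {α β : Type*} (f : α → β) (l : List α) (h : ¬ (l.map f).Nodup) :
    ∃ l₁ a l₂ c l₃, l = l₁ ++ (a :: l₂ ++ c :: l₃) ∧ f a = f c := by
  induction l with
  | nil => simp at h
  | cons a l ih =>
    rw [List.map_cons, List.nodup_cons, not_and_or, not_not] at h
    rcases h with h | h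
    · obtain ⟨c, hc, hca⟩ := List.mem_map.1 h
      obtain ⟨s, t, rfl⟩ := List.append_of_mem hc
      exact ⟨[], a, s, c, t, by simp, hca.symm⟩
    · obtain ⟨l₁, a', l₂, c, l₃, rfl, hf⟩ := ih h
      exact ⟨a :: l₁, a', l₂, c, l₃, by simp, hf⟩

lemma IsWalk.cut {u v : ZMod n} {l₁ l₂ l₃ : List (Arc m n)} {a c : Arc m n}
    (h : IsWalk ℓ k u (l₁ ++ (a :: l₂ ++ c :: l₃)) v)
    (hac : Arc.tail ℓ k a = Arc.tail ℓ k c) :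
    IsWalk ℓ k (Arc.tail ℓ k a) (a :: l₂) (Arc.tail ℓ k a) ∧
      IsWalk ℓ k u (l₁ ++ c :: l₃) v := by
  rw [isWalk_append] at h
  obtain ⟨w, h1, h⟩ := h
  rw [isWalk_append] at h
  obtain ⟨w', h2, h3⟩ := h
  obtain ⟨hw, h2⟩ := h2
  have hw' := h3.1
  subst hw
  subst hw'
  refine ⟨⟨rfl, hac ▸ h2⟩, (isWalk_append ℓ k _ _ _ _).2 ⟨_, h1, ?_⟩⟩
  rw [hac]
  exact h3

/-- The walk of `e` forward short arcs starting at `u`. -/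
def fwdShorts : ZMod n → ℕ → List (Arc m n)
  | _, 0 => []
  | u, e + 1 => Arc.fwdShort (u + 1) :: fwdShorts (u + 1) e

/-- The walk of `e` reverse short arcs starting at `u`. -/
def revShorts : ZMod n → ℕ → List (Arc m n)
  | _, 0 => []
  | u, e + 1 => Arc.revShort u :: revShorts (u - 1) e

lemma isWalk_fwdShorts (u : ZMod n) (e : ℕ) :
    IsWalk ℓ k u (fwdShorts u e) (u + e) := by
  induction e generalizing u with
  | zero => simp [fwdShorts, IsWalk]
  | succ e ih =>
    refine ⟨by simp [Arc.tail], ?_⟩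
    have := ih (u + 1)
    rw [add_assoc, add_comm 1] at this
    simpa [Arc.head] using this

lemma isWalk_revShorts (u : ZMod n) (e : ℕ) :
    IsWalk ℓ k u (revShorts u e) (u - e) := by
  induction e generalizing u with
  | zero => simp [revShorts, IsWalk]
  | succ e ih =>
    refine ⟨by simp [Arc.tail], ?_⟩
    have := ih (u - 1)
    rw [sub_sub, add_comm 1] at this
    simpa [Arc.head] using this

lemma windingSum_fwdShorts (u : ZMod n) (e : ℕ) :
    windingSum k (fwdShorts u e : List (Arc m n)) = e := by
  induction e generalizing u with
  | zero => simp [fwdShorts, windingSum]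
  | succ e ih =>
    have := ih (u + 1)
    simp only [windingSum, fwdShorts, List.map_cons, List.sum_cons, Arc.len] at this ⊢
    rw [this]
    push_cast
    ring

lemma windingSum_revShorts (u : ZMod n) (e : ℕ) :
    windingSum k (revShorts u e : List (Arc m n)) = -e := by
  induction e generalizing u with
  | zero => simp [revShorts, windingSum]
  | succ e ih =>
    have := ih (u - 1)
    simp only [windingSum, revShorts, List.map_cons, List.sum_cons, Arc.len] at this ⊢
    rw [this]
    push_cast
    ring

lemma mem_fwdShorts {u : ZMod n} {e : ℕ} {a : Arc m n} (h : a ∈ fwdShorts u e) :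
    ∃ j, a = Arc.fwdShort j := by
  induction e generalizing u with
  | zero => simp [fwdShorts] at h
  | succ e ih =>
    rcases List.mem_cons.1 h with rfl | h
    · exact ⟨_, rfl⟩
    · exact ih h

lemma mem_revShorts {u : ZMod n} {e : ℕ} {a : Arc m n} (h : a ∈ revShorts u e) :
    ∃ j, a = Arc.revShort j := by
  induction e generalizing u with
  | zero => simp [revShorts] at h
  | succ e ih =>
    rcases List.mem_cons.1 h with rfl | h
    · exact ⟨_, rfl⟩
    · exact ih h

/-- Neither a forward nor a reverse row arc. -/
def Arc.IsShort : Arc m n → Prop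
  | fwdShort _ => True
  | revShort _ => True
  | _ => False

lemma tVal_eq_zero_of_isShort (b : Fin m → ℤ) {γ : List (Arc m n)}
    (h : ∀ a ∈ γ, Arc.IsShort a) : tVal b γ = 0 := by
  refine List.sum_eq_zero fun z hz => ?_
  obtain ⟨a, ha, rfl⟩ := List.mem_map.1 hz
  have := h a ha
  cases a <;> simp_all [Arc.IsShort]

lemma tVal_nonpos_of_no_fwdRow {b : Fin m → ℤ} (hb : ∀ i, 0 ≤ b i) {γ : List (Arc m n)}
    (h : ∀ i, Arc.fwdRow i ∉ γ) : tVal b γ ≤ 0 := by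
  induction γ with
  | nil => simp [tVal]
  | cons a γ ih =>
    have h1 := ih fun i hi => h i (List.mem_cons_of_mem _ hi)
    simp only [tVal, List.map_cons, List.sum_cons] at h1 ⊢
    cases a with
    | fwdRow i => exact absurd List.mem_cons_self (h i)
    | fwdShort j => simpa using h1
    | revRow i =>
      have := hb i
      simp only
      linarith
    | revShort j => simpa using h1

lemma tMinusVal_eq_zero (b : Fin m → ℤ) {γ : List (Arc m n)} (hγ : ∀ a ∈ γ, ¬ Arc.IsRevRow a) :
    tMinusVal b γ = 0 := by
  refine List.sum_eq_zero fun z hz => ?_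
  obtain ⟨a, ha, rfl⟩ := List.mem_map.1 hz
  have := hγ a ha
  cases a <;> simp_all [Arc.IsRevRow]

/-- Between a forward row arc and a later reverse row arc there are two such row arcs
separated by short arcs only. -/
lemma exists_fwdRow_shorts_revRow (j : Fin m) (γ : List (Arc m n)) (i : Fin m)
    (hi : Arc.revRow i ∈ γ) :
    ∃ (γ₁ : List (Arc m n)) (j' : Fin m) (σ : List (Arc m n)) (i' : Fin m)
      (γ₂ : List (Arc m n)), (∀ a ∈ σ, Arc.IsShort a) ∧
      Arc.fwdRow j :: γ = γ₁ ++ ((Arc.fwdRow j' :: σ ++ [Arc.revRow i']) ++ γ₂) := by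
  suffices H : ∀ τ : List (Arc m n), (∀ a ∈ τ, Arc.IsShort a) →
      ∃ (γ₁ : List (Arc m n)) (j' : Fin m) (σ : List (Arc m n)) (i' : Fin m)
      (γ₂ : List (Arc m n)), (∀ a ∈ σ, Arc.IsShort a) ∧
      Arc.fwdRow j :: τ ++ γ = γ₁ ++ ((Arc.fwdRow j' :: σ ++ [Arc.revRow i']) ++ γ₂) by
    simpa using H [] (by simp)
  induction γ generalizing j with
  | nil => simp at hi
  | cons a γ ih =>
    intro τ hτ
    have hshort : Arc.IsShort a → Arc.revRow i ∈ γ →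
        ∃ (γ₁ : List (Arc m n)) (j' : Fin m) (σ : List (Arc m n)) (i' : Fin m)
        (γ₂ : List (Arc m n)), (∀ a ∈ σ, Arc.IsShort a) ∧
        Arc.fwdRow j :: τ ++ a :: γ =
          γ₁ ++ ((Arc.fwdRow j' :: σ ++ [Arc.revRow i']) ++ γ₂) := by
      intro ha hγ
      have := ih j hγ (τ ++ [a]) (by
        intro c hc
        rcases List.mem_append.1 hc with hc | hc
        · exact hτ c hc
        · rw [List.mem_singleton.1 hc]
          exact ha)
      simpa using this
    cases a with
    | fwdRow j' =>
      have hγ : Arc.revRow i ∈ γ := by simpa using hi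
      obtain ⟨γ₁, j'', σ, i', γ₂, hσ, h⟩ := ih j' hγ [] (by simp)
      refine ⟨Arc.fwdRow j :: τ ++ γ₁, j'', σ, i', γ₂, hσ, ?_⟩
      rw [List.append_assoc _ γ₁, ← h]
      simp
    | revRow i' => exact ⟨[], j, τ, i', γ, hτ, by simp⟩
    | fwdShort _ => exact hshort trivial (by simpa using hi)
    | revShort _ => exact hshort trivial (by simpa using hi)

end Walks

lemma sum_range_potential (ξ : ZMod n → ℝ) (c : ℝ) (a : ZMod n) (N : ℕ) :
    ∑ s ∈ Finset.range N, (ξ (a + s) - ξ (a + s - 1) + c) = ξ (a + N - 1) - ξ (a - 1) + N * c := by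
  induction N with
  | zero => simp
  | succ N ih =>
    rw [Finset.sum_range_succ, ih]
    push_cast
    rw [← add_assoc a, add_sub_cancel_right]
    ring

section Slacks

variable [NeZero n] (ℓ : Fin m → ZMod n) (k : Fin m → ℕ) (b : Fin m → ℤ) (x : ZMod n → ℝ)

/-- The slack at `x` of the constraint of a forward arc. -/
noncomputable def fwdSlack : Arc m n → ℝ
  | Arc.fwdRow i => rowSlack ℓ k b x i
  | Arc.fwdShort j => x j
  | _ => 0

/-- The slack at `x` of the constraint of a reverse arc. -/
noncomputable def revSlack : Arc m n → ℝ
  | Arc.revRow i => rowSlack ℓ k b x i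
  | Arc.revShort j => x j
  | _ => 0

/-- Total slack of the forward arcs of `γ`. -/
noncomputable def fwdSum (γ : List (Arc m n)) : ℝ := (γ.map (fwdSlack ℓ k b x)).sum

/-- Total slack of the reverse arcs of `γ`. -/
noncomputable def revSum (γ : List (Arc m n)) : ℝ := (γ.map (revSlack ℓ k b x)).sum

/-- The cost of `γ` when the arc costs are spread uniformly over the nodes. -/
noncomputable def weight (μ : ℝ) (γ : List (Arc m n)) : ℝ :=
  μ * fwdSum ℓ k b x γ + (1 - μ) * revSum ℓ k b x γ - μ * (1 - μ) * (windingSum k γ / n)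

lemma fwdSum_append (γ₁ γ₂ : List (Arc m n)) :
    fwdSum ℓ k b x (γ₁ ++ γ₂) = fwdSum ℓ k b x γ₁ + fwdSum ℓ k b x γ₂ := by
  simp [fwdSum]

lemma revSum_append (γ₁ γ₂ : List (Arc m n)) :
    revSum ℓ k b x (γ₁ ++ γ₂) = revSum ℓ k b x γ₁ + revSum ℓ k b x γ₂ := by
  simp [revSum]

lemma weight_append (μ : ℝ) (γ₁ γ₂ : List (Arc m n)) :
    weight ℓ k b x μ (γ₁ ++ γ₂) = weight ℓ k b x μ γ₁ + weight ℓ k b x μ γ₂ := by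
  simp only [weight, fwdSum_append, revSum_append, windingSum_append, Int.cast_add]
  ring

variable {ℓ k b x}

lemma rowSlack_nonneg (hx : x ∈ Qpoly (circMatrix ℓ k) (fun i => (b i : ℝ))) (i : Fin m) :
    0 ≤ rowSlack ℓ k b x i :=
  sub_nonneg.2 (hx.2 i)

lemma fwdSlack_nonneg (hx : x ∈ Qpoly (circMatrix ℓ k) (fun i => (b i : ℝ))) (a : Arc m n) :
    0 ≤ fwdSlack ℓ k b x a := by
  cases a with
  | fwdRow i => exact rowSlack_nonneg hx i
  | fwdShort j => exact hx.1 j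
  | revRow _ => exact le_rfl
  | revShort _ => exact le_rfl

lemma revSlack_nonneg (hx : x ∈ Qpoly (circMatrix ℓ k) (fun i => (b i : ℝ))) (a : Arc m n) :
    0 ≤ revSlack ℓ k b x a := by
  cases a with
  | revRow i => exact rowSlack_nonneg hx i
  | revShort j => exact hx.1 j
  | fwdRow _ => exact le_rfl
  | fwdShort _ => exact le_rfl

lemma fwdSum_nonneg (hx : x ∈ Qpoly (circMatrix ℓ k) (fun i => (b i : ℝ)))
    (γ : List (Arc m n)) : 0 ≤ fwdSum ℓ k b x γ := by
  refine List.sum_nonneg fun z hz => ?_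
  obtain ⟨a, -, rfl⟩ := List.mem_map.1 hz
  exact fwdSlack_nonneg hx a

lemma revSum_nonneg (hx : x ∈ Qpoly (circMatrix ℓ k) (fun i => (b i : ℝ)))
    (γ : List (Arc m n)) : 0 ≤ revSum ℓ k b x γ := by
  refine List.sum_nonneg fun z hz => ?_
  obtain ⟨a, -, rfl⟩ := List.mem_map.1 hz
  exact revSlack_nonneg hx a

lemma row_sum_potential (hk : ∀ i, k i ≤ n) {ξ : ZMod n → ℝ} {c : ℝ}
    (hξ : ∀ j, x j = ξ j - ξ (j - 1) + c) (i : Fin m) :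
    ∑ j, circMatrix ℓ k i j * x j = ξ (ℓ i + k i - 1) - ξ (ℓ i - 1) + k i * c := by
  rw [circMatrix_row_sum ℓ k i (hk i), ← sum_range_potential]
  exact Finset.sum_congr rfl fun s _ => hξ _

lemma arc_balance (hk : ∀ i, k i ≤ n) {ξ : ZMod n → ℝ} {c : ℝ}
    (hξ : ∀ j, x j = ξ j - ξ (j - 1) + c) (a : Arc m n) :
    fwdSlack ℓ k b x a - revSlack ℓ k b x a + (tVal b [a] : ℝ) =
      ξ (Arc.head ℓ k a) - ξ (Arc.tail ℓ k a) + c * (Arc.len k a : ℤ) := by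
  cases a with
  | fwdRow i =>
    simp only [fwdSlack, revSlack, tVal, Arc.head, Arc.tail, Arc.len, rowSlack,
      row_sum_potential hk hξ]
    push_cast [List.map_cons, List.map_nil, List.sum_singleton]
    ring
  | revRow i =>
    simp only [fwdSlack, revSlack, tVal, Arc.head, Arc.tail, Arc.len, rowSlack,
      row_sum_potential hk hξ]
    push_cast [List.map_cons, List.map_nil, List.sum_singleton]
    ring
  | fwdShort j => simp [fwdSlack, revSlack, tVal, Arc.head, Arc.tail, Arc.len, ← hξ j]
  | revShort j =>
    simp only [fwdSlack, revSlack, tVal, Arc.head, Arc.tail, Arc.len, hξ j]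
    push_cast [List.map_cons, List.map_nil, List.sum_singleton]
    ring

lemma IsWalk.balance (hk : ∀ i, k i ≤ n) {ξ : ZMod n → ℝ} {c : ℝ}
    (hξ : ∀ j, x j = ξ j - ξ (j - 1) + c) {γ : List (Arc m n)} {u v : ZMod n}
    (h : IsWalk ℓ k u γ v) :
    fwdSum ℓ k b x γ - revSum ℓ k b x γ + (tVal b γ : ℝ) =
      ξ v - ξ u + c * (windingSum k γ : ℤ) := by
  induction γ generalizing u with
  | nil =>
    obtain rfl : u = v := h
    simp [fwdSum, revSum, tVal, windingSum]
  | cons a γ ih =>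
    obtain ⟨rfl, h⟩ := h
    have h1 := ih h
    have h2 := arc_balance (ℓ := ℓ) (b := b) hk hξ a
    rw [← List.singleton_append, fwdSum_append, revSum_append, tVal_append, windingSum_append]
    have e1 : fwdSum ℓ k b x [a] = fwdSlack ℓ k b x a := by simp [fwdSum]
    have e2 : revSum ℓ k b x [a] = revSlack ℓ k b x a := by simp [revSum]
    have e3 : windingSum k [a] = Arc.len k a := by simp [windingSum]
    rw [e1, e2, e3, Int.cast_add, Int.cast_add]
    linarith

lemma IsWalk.closed_balance (hk : ∀ i, k i ≤ n) {γ : List (Arc m n)} {u : ZMod n}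
    (h : IsWalk ℓ k u γ u) {p : ℤ} (hp : p * (n : ℤ) = windingSum k γ) :
    fwdSum ℓ k b x γ - revSum ℓ k b x γ + (tVal b γ : ℝ) = p * ∑ j, x j := by
  obtain ⟨ξ, hξ⟩ := exists_potential x
  have hn : (n : ℝ) ≠ 0 := Nat.cast_ne_zero.2 (NeZero.ne n)
  rw [h.balance hk hξ, ← hp]
  push_cast
  field_simp
  ring

lemma sum_pMinus (x : ZMod n → ℝ) {γ : List (Arc m n)} (hγ : ∀ a ∈ γ, ¬ Arc.IsRevRow a) :
    ∑ j, (pMinus ℓ k γ j : ℝ) * x j = revSum ℓ k b x γ := by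
  induction γ with
  | nil => simp [pMinus, revSum]
  | cons a γ ih =>
    have h1 := ih fun c hc => hγ c (List.mem_cons_of_mem _ hc)
    have ha := hγ a List.mem_cons_self
    have h2 : ∀ j, (pMinus ℓ k (a :: γ) j : ℝ) =
        pMinus ℓ k γ j + if ¬ Arc.IsForward a ∧ Arc.Jumps ℓ k a j then 1 else 0 := by
      intro j
      simp only [pMinus, List.countP_cons, decide_eq_true_eq]
      push_cast
      rfl
    simp only [h2, add_mul, Finset.sum_add_distrib, h1]
    simp only [revSum, List.map_cons, List.sum_cons]
    rw [add_comm]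
    congr 1
    cases a with
    | fwdRow i => simp [Arc.IsForward, revSlack]
    | fwdShort j => simp [Arc.IsForward, revSlack]
    | revRow i => exact absurd trivial ha
    | revShort j => simp [Arc.IsForward, Arc.Jumps, revSlack]

lemma gammaIneqHolds_iff {γ : List (Arc m n)} (hγ : ∀ a ∈ γ, ¬ Arc.IsRevRow a) (p : ℤ) :
    GammaIneqHolds ℓ k b γ p x ↔
      (rVal b γ p : ℝ) * ((betaVal b γ p : ℝ) + 1) ≤
        revSum ℓ k b x γ + rVal b γ p * ∑ j, x j := by
  rw [GammaIneqHolds, tMinusVal_eq_zero b hγ, ← sum_pMinus x hγ, Finset.mul_sum,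
    ← Finset.sum_add_distrib]
  simp only [add_mul, Int.cast_zero, add_zero, ge_iff_le]

end Slacks

lemma gammaIneqHolds_of_isIntegerPoint [NeZero n] {ℓ : Fin m → ZMod n} {k : Fin m → ℕ}
    (hk : ∀ i, k i ≤ n) {b : Fin m → ℤ} {x : ZMod n → ℝ} (hintegral : IsIntegerPoint x)
    (hx : x ∈ Qpoly (circMatrix ℓ k) (fun i => (b i : ℝ))) {γ : List (Arc m n)} {p : ℤ}
    (hγ : IsClosedWalk ℓ k γ) (hrev : ∀ a ∈ γ, ¬ Arc.IsRevRow a)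
    (hp : p * (n : ℤ) = windingSum k γ) (hp0 : 0 < p) :
    GammaIneqHolds ℓ k b γ p x := by
  obtain ⟨-, u, hw⟩ := (isClosedWalk_iff ℓ k γ).1 hγ
  rw [gammaIneqHolds_iff hrev]
  choose z hz using hintegral
  have hy : ∑ j, x j = ((∑ j, z j : ℤ) : ℝ) := by
    push_cast
    exact Finset.sum_congr rfl fun j _ => hz j
  have hbal := hw.closed_balance (b := b) (x := x) hk hp
  have hF := fwdSum_nonneg hx γ
  have hR := revSum_nonneg hx γ
  rw [hy] at hbal ⊢
  have hr0 : 0 ≤ rVal b γ p := by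
    rw [rVal, betaVal, Int.fdiv_eq_ediv_of_nonneg _ hp0.le]
    have := Int.ediv_mul_le (tVal b γ) hp0.ne'
    omega
  have hrp : rVal b γ p ≤ p := by
    rw [rVal, betaVal, Int.fdiv_eq_ediv_of_nonneg _ hp0.le]
    have := Int.lt_ediv_add_one_mul_self (tVal b γ) hp0
    rw [add_mul, one_mul] at this
    omega
  have ht : (tVal b γ : ℝ) = rVal b γ p + betaVal b γ p * p := by
    rw [rVal]
    push_cast
    ring
  set r := rVal b γ p
  set β := betaVal b γ p
  set y : ℤ := ∑ j, z j
  rw [ht] at hbal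
  have hr0' : (0 : ℝ) ≤ r := by exact_mod_cast hr0
  have hrp' : (r : ℝ) ≤ p := by exact_mod_cast hrp
  rcases le_or_gt y β with h | h
  · have h' : (y : ℝ) ≤ β := by exact_mod_cast h
    nlinarith [mul_nonneg (sub_nonneg.2 hrp') (sub_nonneg.2 h')]
  · have h' : (β : ℝ) + 1 ≤ y := by exact_mod_cast h
    nlinarith [mul_nonneg hr0' (sub_nonneg.2 h')]

lemma convex_setOf_gammaIneqHolds [NeZero n] (ℓ : Fin m → ZMod n) (k : Fin m → ℕ)
    (b : Fin m → ℤ) (γ : List (Arc m n)) (p : ℤ) :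
    Convex ℝ {x | GammaIneqHolds ℓ k b γ p x} := by
  refine convex_halfSpace_ge ⟨fun x y => ?_, fun c x => ?_⟩ _
  · simp [mul_add, Finset.sum_add_distrib]
  · simp only [Pi.smul_apply, smul_eq_mul, Finset.mul_sum]
    exact Finset.sum_congr rfl fun j _ => by ring

lemma convex_Qpoly [NeZero n] (A : Matrix (Fin m) (ZMod n) ℝ) (b : Fin m → ℝ) :
    Convex ℝ (Qpoly A b) := by
  intro x hx y hy s t hs ht hst
  refine ⟨fun j => add_nonneg (mul_nonneg hs (hx.1 j)) (mul_nonneg ht (hy.1 j)), fun i => ?_⟩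
  have h1 := mul_le_mul_of_nonneg_left (hx.2 i) hs
  have h2 := mul_le_mul_of_nonneg_left (hy.2 i) ht
  have h3 : ∑ j, A i j * (s • x + t • y) j =
      s * ∑ j, A i j * x j + t * ∑ j, A i j * y j := by
    simp only [Pi.add_apply, Pi.smul_apply, smul_eq_mul, Finset.mul_sum,
      ← Finset.sum_add_distrib]
    exact Finset.sum_congr rfl fun j _ => by ring
  rw [h3]
  calc b i = s * b i + t * b i := by rw [← add_mul, hst, one_mul]
    _ ≤ _ := add_le_add h1 h2

lemma dominates_of_inInterval {ℓ : Fin m → ZMod n} {k : Fin m → ℕ} {i j : Fin m}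
    (hij : i ≠ j) (h : ∀ z, inInterval (ℓ j) (k j) z → inInterval (ℓ i) (k i) z) :
    Dominates (circMatrix ℓ k) i j := by
  refine ⟨hij, fun z => ?_⟩
  unfold circMatrix
  split_ifs with h1 h2
  · exact le_rfl
  · exact absurd (h z h1) h2
  · exact zero_le_one
  · exact le_rfl

section Weights

variable [NeZero n] {ℓ : Fin m → ZMod n} {k : Fin m → ℕ} {b : Fin m → ℤ} {x : ZMod n → ℝ}
  {μ : ℝ} {β : ℤ}

lemma IsWalk.weight_eq_rev (hk : ∀ i, k i ≤ n) (hβ : ∑ j, x j = β + 1 - μ)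
    {γ : List (Arc m n)} {u : ZMod n} (hw : IsWalk ℓ k u γ u) {p : ℤ}
    (hp : p * (n : ℤ) = windingSum k γ) :
    weight ℓ k b x μ γ = revSum ℓ k b x γ - μ * (tVal b γ - p * β) := by
  have hbal := hw.closed_balance (b := b) (x := x) hk hp
  have hn : (n : ℝ) ≠ 0 := Nat.cast_ne_zero.2 (NeZero.ne n)
  rw [hβ] at hbal
  have hF : fwdSum ℓ k b x γ =
      revSum ℓ k b x γ - tVal b γ + p * (β + 1 - μ) := by linarith
  rw [weight, ← hp, hF]
  push_cast
  field_simp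
  ring

lemma IsWalk.weight_eq_fwd (hk : ∀ i, k i ≤ n) (hβ : ∑ j, x j = β + 1 - μ)
    {γ : List (Arc m n)} {u : ZMod n} (hw : IsWalk ℓ k u γ u) {p : ℤ}
    (hp : p * (n : ℤ) = windingSum k γ) :
    weight ℓ k b x μ γ = fwdSum ℓ k b x γ - (1 - μ) * (p * (β + 1) - tVal b γ) := by
  have hbal := hw.closed_balance (b := b) (x := x) hk hp
  rw [hβ] at hbal
  rw [hw.weight_eq_rev hk hβ hp]
  linarith

lemma IsWalk.winding_of_weight_neg (hk : ∀ i, k i ≤ n)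
    (hx : x ∈ Qpoly (circMatrix ℓ k) (fun i => (b i : ℝ)))
    (hμ0 : 0 < μ) (hμ1 : μ < 1) (hβ : ∑ j, x j = β + 1 - μ) {γ : List (Arc m n)}
    {u : ZMod n} (hw : IsWalk ℓ k u γ u) (hneg : weight ℓ k b x μ γ < 0) {p : ℤ}
    (hp : p * (n : ℤ) = windingSum k γ) :
    p * β < tVal b γ ∧ tVal b γ < p * (β + 1) := by
  have hF := fwdSum_nonneg hx γ
  have hR := revSum_nonneg hx γ
  have h1 := hneg
  have h2 := hneg
  rw [hw.weight_eq_rev hk hβ hp] at h1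
  rw [hw.weight_eq_fwd hk hβ hp] at h2
  have h3 : (0 : ℝ) < tVal b γ - p * β := pos_of_mul_pos_right (by linarith) hμ0.le
  have h4 : (0 : ℝ) < p * (β + 1) - tVal b γ :=
    pos_of_mul_pos_right (by linarith) (sub_nonneg.2 hμ1.le)
  constructor
  · exact_mod_cast sub_pos.1 h3
  · exact_mod_cast sub_pos.1 h4

lemma weight_nonneg_of_gammaIneqHolds (hk : ∀ i, k i ≤ n)
    (hx : x ∈ Qpoly (circMatrix ℓ k) (fun i => (b i : ℝ)))
    (hμ0 : 0 < μ) (hμ1 : μ < 1) (hβ : ∑ j, x j = β + 1 - μ)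
    {γ : List (Arc m n)} {u : ZMod n} (hw : IsWalk ℓ k u γ u)
    (hrev : ∀ a ∈ γ, ¬ Arc.IsRevRow a)
    (hΓ : ∀ p : ℤ, p * (n : ℤ) = windingSum k γ → 2 ≤ p → ¬ p ∣ tVal b γ →
      GammaIneqHolds ℓ k b γ p x) :
    0 ≤ weight ℓ k b x μ γ := by
  by_contra! hneg
  obtain ⟨p, hp⟩ := hw.exists_windingNumber
  obtain ⟨h1, h2⟩ := hw.winding_of_weight_neg hk hx hμ0 hμ1 hβ hneg hp
  rw [mul_add, mul_one] at h2
  have hp2 : 2 ≤ p := by omega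
  have hdvd : ¬ p ∣ tVal b γ := by
    rintro ⟨q, hq⟩
    rw [hq] at h1 h2
    have h3 : β < q := lt_of_mul_lt_mul_left h1 (by omega)
    have h4 : q < β + 1 := lt_of_mul_lt_mul_left (by rwa [mul_add, mul_one]) (by omega : 0 ≤ p)
    omega
  have hbeta : betaVal b γ p = β := by
    rw [betaVal, Int.fdiv_eq_ediv_of_nonneg _ (by omega)]
    refine le_antisymm ?_ ?_
    · have : tVal b γ / p < β + 1 :=
        Int.ediv_lt_of_lt_mul (by omega) (by rw [add_mul, one_mul, mul_comm β]; exact h2)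
      omega
    · exact Int.le_ediv_of_mul_le (by omega) (by rw [mul_comm]; exact h1.le)
  have hG := (gammaIneqHolds_iff hrev p).1 (hΓ p hp hp2 hdvd)
  rw [rVal, hbeta, hβ] at hG
  rw [hw.weight_eq_rev hk hβ hp] at hneg
  push_cast at hG
  linarith

/-- Nonnegativity of the weight passes from simple circuits to closed walks. -/
lemma weight_nonneg_of_circuits (μ : ℝ)
    (H : ∀ γ : List (Arc m n), IsCircuit ℓ k γ → (∀ a ∈ γ, ¬ Arc.IsRevRow a) →
      0 ≤ weight ℓ k b x μ γ)
    (γ : List (Arc m n)) (u : ZMod n) (hw : IsWalk ℓ k u γ u)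
    (hrev : ∀ a ∈ γ, ¬ Arc.IsRevRow a) : 0 ≤ weight ℓ k b x μ γ := by
  induction hN : γ.length using Nat.strong_induction_on generalizing γ u with
  | _ N ih =>
    subst hN
    by_cases hnil : γ = []
    · simp [hnil, weight, fwdSum, revSum, windingSum]
    by_cases hnd : (γ.map (Arc.tail ℓ k)).Nodup
    · exact H γ ⟨(isClosedWalk_iff ℓ k γ).2 ⟨hnil, u, hw⟩, hnd⟩ hrev
    obtain ⟨l₁, a, l₂, c, l₃, rfl, hac⟩ := exists_duplicate_split _ _ hnd
    obtain ⟨hc1, hc2⟩ := hw.cut hac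
    have h1 := ih _ (by simp; omega) (a :: l₂) _ hc1
      (fun d hd => hrev d (List.mem_append_right _ (List.mem_append_left _ hd))) rfl
    have h2 := ih _ (by simp) (l₁ ++ c :: l₃) _ hc2 (fun d hd => by
      rcases List.mem_append.1 hd with hd | hd
      · exact hrev d (List.mem_append_left _ hd)
      · exact hrev d (List.mem_append_right _ (List.mem_append_right _ hd))) rfl
    rw [weight_append] at h2
    rw [weight_append, weight_append]
    linarith

lemma fwdSum_revShorts (u : ZMod n) (e : ℕ) :
    fwdSum ℓ k b x (revShorts u e : List (Arc m n)) = 0 := by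
  refine List.sum_eq_zero fun z hz => ?_
  obtain ⟨a, ha, rfl⟩ := List.mem_map.1 hz
  obtain ⟨j, rfl⟩ := mem_revShorts ha
  rfl

lemma revSum_fwdShorts (u : ZMod n) (e : ℕ) :
    revSum ℓ k b x (fwdShorts u e : List (Arc m n)) = 0 := by
  refine List.sum_eq_zero fun z hz => ?_
  obtain ⟨a, ha, rfl⟩ := List.mem_map.1 hz
  obtain ⟨j, rfl⟩ := mem_fwdShorts ha
  rfl

/-- In the absence of dominating rows, a forward row arc followed by short arcs and a reverse
row arc can be replaced by short arcs without increasing the weight. -/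
lemma exists_short_replacement (hk : ∀ i, k i ≤ n)
    (hdom : NoDominatingRows (circMatrix ℓ k)) {α : ℤ}
    (hx : x ∈ Qpoly (circMatrix ℓ k) (fun _ => (α : ℝ)))
    (i j : Fin m) {σ : List (Arc m n)} (hσ : ∀ a ∈ σ, Arc.IsShort a)
    {u v : ZMod n} (hw : IsWalk ℓ k u (Arc.fwdRow j :: σ ++ [Arc.revRow i]) v) :
    ∃ τ, IsWalk ℓ k u τ v ∧ (∀ a ∈ τ, Arc.IsShort a) ∧
      weight ℓ k (fun _ => α) x μ τ ≤
        weight ℓ k (fun _ => α) x μ (Arc.fwdRow j :: σ ++ [Arc.revRow i]) := by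
  set ρ := Arc.fwdRow j :: σ ++ [Arc.revRow i] with hρ
  set D := windingSum k σ with hD
  have hW : windingSum k ρ = k j + D - k i := by
    simp only [hρ, hD, windingSum, List.map_append, List.map_cons, List.map_nil, List.sum_append,
      List.sum_cons, List.sum_nil, Arc.len]
    ring
  have ht : tVal (fun _ => α) ρ = 0 := by
    have h0 := tVal_eq_zero_of_isShort (fun _ => α) hσ
    simp only [hρ, tVal, List.map_append, List.map_cons, List.map_nil, List.sum_append,
      List.sum_cons, List.sum_nil] at h0 ⊢
    omega
  have hvu := hw.windingSum_cast
  obtain ⟨ξ, hξ⟩ := exists_potential x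
  have hbal := hw.balance (b := fun _ => α) hk hξ
  have hF := fwdSum_nonneg (b := fun _ => α) hx ρ
  have hR := revSum_nonneg (b := fun _ => α) hx ρ
  have hu : u = ℓ j - 1 := by
    obtain ⟨h, -⟩ := hw
    exact h.symm
  have hv : v = ℓ i - 1 := by
    obtain ⟨w, -, h⟩ := (isWalk_append ℓ k _ _ _ _).1 hw
    obtain ⟨-, h⟩ := h
    exact h.symm
  have hℓ : ℓ i = ℓ j + ((k j + D - k i : ℤ) : ZMod n) := by
    rw [← hW, hvu, hu, hv]
    ring
  set e : ℤ := k j + D - k i with he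
  rcases le_or_gt 0 D with hD0 | hD0
  · have he0 : 0 ≤ e := by
      by_contra! hneg
      by_cases hij : i = j
      · subst hij
        omega
      refine hdom i j (dominates_of_inInterval hij ?_)
      rintro z ⟨s, hs, rfl⟩
      refine ⟨(-e).toNat + s, by omega, ?_⟩
      have hcast : (((-e).toNat : ℕ) : ZMod n) = -(e : ZMod n) := by
        rw [← Int.cast_natCast, Int.toNat_of_nonneg (by omega), Int.cast_neg]
      rw [hℓ]
      push_cast
      rw [hcast]
      ring
    obtain ⟨E, hE⟩ := Int.eq_ofNat_of_zero_le he0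
    have hwalk := isWalk_fwdShorts (ℓ := ℓ) (k := k) u E
    have hend : u + (E : ZMod n) = v := by
      rw [hW, hE, Int.cast_natCast] at hvu
      rw [hvu]
      ring
    rw [hend] at hwalk
    have hshort : ∀ a ∈ (fwdShorts u E : List (Arc m n)), Arc.IsShort a := by
      intro a ha
      obtain ⟨_, rfl⟩ := mem_fwdShorts ha
      trivial
    refine ⟨fwdShorts u E, hwalk, hshort, ?_⟩
    have hbal' := hwalk.balance (b := fun _ => α) hk hξ
    rw [tVal_eq_zero_of_isShort _ hshort, windingSum_fwdShorts, revSum_fwdShorts, ← hE] at hbal'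
    rw [ht, hW] at hbal
    rw [weight, weight, hW, windingSum_fwdShorts, ← hE, revSum_fwdShorts]
    have hFeq : fwdSum ℓ k (fun _ => α) x (fwdShorts u E) =
        fwdSum ℓ k (fun _ => α) x ρ - revSum ℓ k (fun _ => α) x ρ := by linarith
    rw [hFeq]
    linarith
  · have he0 : e < 0 := by
      by_contra! hneg
      by_cases hij : i = j
      · subst hij
        omega
      refine hdom j i (dominates_of_inInterval (Ne.symm hij) ?_)
      rintro z ⟨s, hs, rfl⟩
      refine ⟨e.toNat + s, by omega, ?_⟩
      have hcast : ((e.toNat : ℕ) : ZMod n) = (e : ZMod n) := by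
        rw [← Int.cast_natCast, Int.toNat_of_nonneg (by omega)]
      rw [hℓ]
      push_cast
      rw [hcast]
      ring
    obtain ⟨E, hE⟩ := Int.eq_ofNat_of_zero_le (by omega : 0 ≤ -e)
    have hE' : e = -(E : ℤ) := by omega
    have hwalk := isWalk_revShorts (ℓ := ℓ) (k := k) u E
    have hend : u - (E : ZMod n) = v := by
      rw [hW, hE', Int.cast_neg, Int.cast_natCast] at hvu
      rw [sub_eq_add_neg, hvu]
      ring
    rw [hend] at hwalk
    have hshort : ∀ a ∈ (revShorts u E : List (Arc m n)), Arc.IsShort a := by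
      intro a ha
      obtain ⟨_, rfl⟩ := mem_revShorts ha
      trivial
    refine ⟨revShorts u E, hwalk, hshort, ?_⟩
    have hbal' := hwalk.balance (b := fun _ => α) hk hξ
    rw [tVal_eq_zero_of_isShort _ hshort, windingSum_revShorts, fwdSum_revShorts, ← hE'] at hbal'
    rw [ht, hW] at hbal
    rw [weight, weight, hW, windingSum_revShorts, ← hE', fwdSum_revShorts]
    have hReq : revSum ℓ k (fun _ => α) x (revShorts u E) =
        revSum ℓ k (fun _ => α) x ρ - fwdSum ℓ k (fun _ => α) x ρ := by linarith
    rw [hReq]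
    linarith

lemma weight_rotate (μ : ℝ) (γ₁ γ₂ : List (Arc m n)) :
    weight ℓ k b x μ (γ₂ ++ γ₁) = weight ℓ k b x μ (γ₁ ++ γ₂) := by
  rw [weight_append, weight_append, add_comm]

/-- For a homogeneous right-hand side and no dominating rows, nonnegativity of the weight passes
from closed walks without reverse row arcs to all closed walks. -/
lemma weight_nonneg_of_no_revRow (hk : ∀ i, k i ≤ n)
    (hdom : NoDominatingRows (circMatrix ℓ k)) {α : ℤ} (hα : 0 ≤ α)
    (hx : x ∈ Qpoly (circMatrix ℓ k) (fun _ => (α : ℝ)))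
    (hμ0 : 0 < μ) (hμ1 : μ < 1) (hβ : ∑ j, x j = β + 1 - μ)
    (H : ∀ (γ : List (Arc m n)) (u : ZMod n), IsWalk ℓ k u γ u →
      (∀ a ∈ γ, ¬ Arc.IsRevRow a) → 0 ≤ weight ℓ k (fun _ => α) x μ γ)
    (γ : List (Arc m n)) (u : ZMod n) (hw : IsWalk ℓ k u γ u) :
    0 ≤ weight ℓ k (fun _ => α) x μ γ := by
  induction hN : γ.countP (fun a => decide (Arc.IsRevRow a)) using Nat.strong_induction_on
    generalizing γ u with
  | _ N ih =>
    subst hN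
    by_cases hrev : ∀ a ∈ γ, ¬ Arc.IsRevRow a
    · exact H γ u hw hrev
    by_contra! hneg
    obtain ⟨p, hp⟩ := hw.exists_windingNumber
    obtain ⟨h1, h2⟩ := hw.winding_of_weight_neg (b := fun _ => α) hk hx hμ0 hμ1 hβ hneg hp
    have hβ0 : 0 ≤ β := by
      have hy : 0 ≤ ∑ j, x j := Finset.sum_nonneg fun j _ => hx.1 j
      have : (-1 : ℝ) < (β : ℝ) := by linarith
      have : (-1 : ℤ) < β := by exact_mod_cast this
      omega
    have htpos : 0 < tVal (fun _ => α) γ := by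
      rw [mul_add, mul_one] at h2
      have hp1 : 0 ≤ p := by omega
      have := mul_nonneg hp1 hβ0
      omega
    obtain ⟨j, hj⟩ : ∃ j, Arc.fwdRow j ∈ γ := by
      by_contra! hno
      have := tVal_nonpos_of_no_fwdRow (b := fun _ => α) (fun _ => hα) hno
      omega
    obtain ⟨γ₁, γ₂, rfl⟩ := List.append_of_mem hj
    obtain ⟨w, hw1, hw2⟩ := (isWalk_append ℓ k _ _ _ _).1 hw
    have hrot : IsWalk ℓ k w (Arc.fwdRow j :: (γ₂ ++ γ₁)) w :=
      (isWalk_append ℓ k (Arc.fwdRow j :: γ₂) γ₁ w w).2 ⟨u, hw2, hw1⟩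
    push Not at hrev
    obtain ⟨a, ha, har⟩ := hrev
    obtain ⟨i, hi⟩ : ∃ i, Arc.revRow i ∈ γ₂ ++ γ₁ := by
      cases a with
      | revRow i => exact ⟨i, by simpa [or_comm] using ha⟩
      | fwdRow _ => exact har.elim
      | fwdShort _ => exact har.elim
      | revShort _ => exact har.elim
    obtain ⟨δ₁, j', σ, i', δ₂, hσ, hδ⟩ := exists_fwdRow_shorts_revRow j _ i hi
    rw [hδ] at hrot
    obtain ⟨c, hδ1, hrot⟩ := (isWalk_append ℓ k _ _ _ _).1 hrot
    obtain ⟨d, hmid, hδ2⟩ := (isWalk_append ℓ k _ _ _ _).1 hrot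
    obtain ⟨τ, hτw, hτs, hτ⟩ := exists_short_replacement (μ := μ) hk hdom hx i' j' hσ hmid
    have hnew : IsWalk ℓ k w (δ₁ ++ (τ ++ δ₂)) w :=
      (isWalk_append ℓ k _ _ _ _).2 ⟨c, hδ1, (isWalk_append ℓ k _ _ _ _).2 ⟨d, hτw, hδ2⟩⟩
    have hτ0 : τ.countP (fun a => decide (Arc.IsRevRow a)) = 0 := by
      rw [List.countP_eq_zero]
      intro a ha
      rw [decide_eq_true_eq]
      intro hr
      have := hτs a ha
      cases a <;> first | exact hr | exact this
    have hcount : (γ₁ ++ Arc.fwdRow j :: γ₂).countP (fun a => decide (Arc.IsRevRow a)) =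
        (δ₁ ++ (Arc.fwdRow j' :: σ ++ [Arc.revRow i'] ++ δ₂)).countP
          (fun a => decide (Arc.IsRevRow a)) := by
      rw [← hδ, ← List.cons_append, List.countP_append, List.countP_append, add_comm]
    have hlt : (δ₁ ++ (τ ++ δ₂)).countP (fun a => decide (Arc.IsRevRow a)) <
        (γ₁ ++ Arc.fwdRow j :: γ₂).countP (fun a => decide (Arc.IsRevRow a)) := by
      rw [hcount]
      have hdec : decide (Arc.IsRevRow (Arc.revRow i' : Arc m n)) = true := decide_eq_true trivial
      simp only [List.countP_append, List.countP_cons, List.countP_nil, hτ0, if_pos hdec]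
      omega
    have hfin := ih _ hlt _ w hnew rfl
    have hold : weight ℓ k (fun _ => α) x μ (γ₁ ++ Arc.fwdRow j :: γ₂) =
        weight ℓ k (fun _ => α) x μ
          (δ₁ ++ (Arc.fwdRow j' :: σ ++ [Arc.revRow i'] ++ δ₂)) := by
      rw [← hδ, ← List.cons_append, weight_rotate]
    rw [hold, weight_append, weight_append] at hneg
    rw [weight_append, weight_append] at hfin
    linarith

lemma neg_one_le_weight_singleton (hk : ∀ i, k i ≤ n)
    (hx : x ∈ Qpoly (circMatrix ℓ k) (fun i => (b i : ℝ)))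
    (hμ0 : 0 ≤ μ) (hμ1 : μ ≤ 1) (a : Arc m n) : -1 ≤ weight ℓ k b x μ [a] := by
  have hF := mul_nonneg hμ0 (fwdSum_nonneg hx [a])
  have hR := mul_nonneg (sub_nonneg.2 hμ1) (revSum_nonneg hx [a])
  have hn : (0 : ℝ) < n := Nat.cast_pos.2 (NeZero.pos n)
  have hlen : windingSum k [a] ≤ n := by
    have := NeZero.pos n
    cases a with
    | fwdRow i => simpa [windingSum, Arc.len] using hk i
    | revRow i => simp [windingSum, Arc.len]
    | fwdShort j => simp [windingSum, Arc.len]; omega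
    | revShort j => simp [windingSum, Arc.len]
  have hlen' : ((windingSum k [a] : ℤ) : ℝ) / n ≤ 1 := by
    rw [div_le_one hn]
    exact_mod_cast hlen
  have hq : μ * (1 - μ) ≤ 1 := by nlinarith [sq_nonneg μ]
  have h0 : 0 ≤ μ * (1 - μ) := mul_nonneg hμ0 (sub_nonneg.2 hμ1)
  have := mul_le_mul_of_nonneg_left hlen' h0
  rw [weight]
  linarith

lemma weight_bddBelow (hk : ∀ i, k i ≤ n)
    (hx : x ∈ Qpoly (circMatrix ℓ k) (fun i => (b i : ℝ)))
    (hμ0 : 0 ≤ μ) (hμ1 : μ ≤ 1)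
    (H : ∀ (γ : List (Arc m n)) (u : ZMod n), IsWalk ℓ k u γ u → 0 ≤ weight ℓ k b x μ γ)
    (γ : List (Arc m n)) (u v : ZMod n) (hw : IsWalk ℓ k u γ v) :
    -(n : ℝ) ≤ weight ℓ k b x μ γ := by
  have hlen : ∀ γ : List (Arc m n), -(γ.length : ℝ) ≤ weight ℓ k b x μ γ := by
    intro γ
    induction γ with
    | nil => simp [weight, fwdSum, revSum, windingSum]
    | cons a γ ih =>
      rw [← List.singleton_append, weight_append]
      have := neg_one_le_weight_singleton hk hx hμ0 hμ1 a
      simp only [List.singleton_append, List.length_cons, Nat.cast_add, Nat.cast_one]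
      linarith
  induction hN : γ.length using Nat.strong_induction_on generalizing γ with
  | _ N ih =>
    subst hN
    by_cases hnd : (γ.map (Arc.tail ℓ k)).Nodup
    · have h1 := hnd.length_le_card
      rw [ZMod.card, List.length_map] at h1
      have h2 : (γ.length : ℝ) ≤ n := by exact_mod_cast h1
      linarith [hlen γ]
    obtain ⟨l₁, a, l₂, c, l₃, rfl, hac⟩ := exists_duplicate_split _ _ hnd
    obtain ⟨hc1, hc2⟩ := hw.cut hac
    have h1 := H _ _ hc1
    have h2 := ih _ (by simp) (l₁ ++ c :: l₃) hc2 rfl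
    rw [weight_append] at h2
    rw [weight_append, weight_append]
    linarith

/-- Feasible potentials exist when no closed walk has negative weight. -/
lemma exists_feasible_potential (hk : ∀ i, k i ≤ n)
    (hx : x ∈ Qpoly (circMatrix ℓ k) (fun i => (b i : ℝ)))
    (hμ0 : 0 ≤ μ) (hμ1 : μ ≤ 1)
    (H : ∀ (γ : List (Arc m n)) (u : ZMod n), IsWalk ℓ k u γ u → 0 ≤ weight ℓ k b x μ γ) :
    ∃ z : ZMod n → ℝ, ∀ a : Arc m n,
      z (Arc.head ℓ k a) ≤ z (Arc.tail ℓ k a) + weight ℓ k b x μ [a] := by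
  set S : ZMod n → Set ℝ := fun v =>
    {c | ∃ γ u, IsWalk ℓ k u γ v ∧ c = weight ℓ k b x μ γ} with hS
  have hbdd : ∀ v, BddBelow (S v) := by
    intro v
    refine ⟨-(n : ℝ), ?_⟩
    rintro c ⟨γ, u, hw, rfl⟩
    exact weight_bddBelow hk hx hμ0 hμ1 H γ u v hw
  have hne : ∀ v, (S v).Nonempty := fun v => ⟨_, [], v, rfl, rfl⟩
  refine ⟨fun v => sInf (S v), fun a => ?_⟩
  rw [← sub_le_iff_le_add]
  refine le_csInf (hne _) ?_
  rintro c ⟨γ, u, hw, rfl⟩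
  rw [sub_le_iff_le_add, ← weight_append]
  exact csInf_le (hbdd _) ⟨γ ++ [a], u, (isWalk_append ℓ k _ _ _ _).2 ⟨_, hw, ⟨rfl, rfl⟩⟩, rfl⟩

/-- A point of `Q(A, b)` splits as a convex combination of points of `Q(A, b)` lying in the two
neighbouring integral slices, provided no closed walk has negative weight. -/
lemma exists_slice_decomposition (hk : ∀ i, k i ≤ n)
    (hx : x ∈ Qpoly (circMatrix ℓ k) (fun i => (b i : ℝ)))
    (hμ0 : 0 < μ) (hμ1 : μ < 1) (hβ : ∑ j, x j = β + 1 - μ)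
    (H : ∀ (γ : List (Arc m n)) (u : ZMod n), IsWalk ℓ k u γ u → 0 ≤ weight ℓ k b x μ γ) :
    ∃ x₁ ∈ Qpoly (circMatrix ℓ k) (fun i => (b i : ℝ)),
      ∃ x₂ ∈ Qpoly (circMatrix ℓ k) (fun i => (b i : ℝ)),
        ∑ j, x₁ j = β ∧ ∑ j, x₂ j = β + 1 ∧ μ • x₁ + (1 - μ) • x₂ = x := by
  obtain ⟨z, hz⟩ := exists_feasible_potential hk hx hμ0.le hμ1.le H
  have hn : (n : ℝ) ≠ 0 := Nat.cast_ne_zero.2 (NeZero.ne n)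
  have hμ1' : 0 < 1 - μ := sub_pos.2 hμ1
  set c : ℝ := -(μ * (1 - μ) / n) with hc
  set d : ZMod n → ℝ := fun j => -z j - -z (j - 1) + c with hd
  have hdrow := row_sum_potential (ℓ := ℓ) (x := d) (ξ := fun j => -z j) (c := c) hk
    (fun j => rfl)
  have hsum : ∑ j, d j = -(μ * (1 - μ)) := by
    have hshift : ∑ j, z (j - 1) = ∑ j, z j := Equiv.sum_comp (Equiv.subRight 1) z
    simp only [hd, Finset.sum_add_distrib, Finset.sum_sub_distrib, Finset.sum_neg_distrib, hshift,
      Finset.sum_const, Finset.card_univ, ZMod.card, nsmul_eq_mul, hc]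
    field_simp
    ring
  have hfs : ∀ j, -(μ * x j) ≤ d j := by
    intro j
    have := hz (Arc.fwdShort j)
    simp [weight, fwdSum, revSum, windingSum, Arc.head, Arc.tail, Arc.len, fwdSlack,
      revSlack] at this
    simp only [hd, hc]
    rw [div_eq_mul_inv]
    linarith
  have hrs : ∀ j, d j ≤ (1 - μ) * x j := by
    intro j
    have := hz (Arc.revShort j)
    simp [weight, fwdSum, revSum, windingSum, Arc.head, Arc.tail, Arc.len, fwdSlack,
      revSlack, neg_div] at this
    simp only [hd, hc]
    rw [div_eq_mul_inv]
    linarith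
  have hfr : ∀ i, -(μ * rowSlack ℓ k b x i) ≤ ∑ j, circMatrix ℓ k i j * d j := by
    intro i
    have := hz (Arc.fwdRow i)
    simp [weight, fwdSum, revSum, windingSum, Arc.head, Arc.tail, Arc.len, fwdSlack,
      revSlack] at this
    rw [hdrow, hc]
    have h : (k i : ℝ) * -(μ * (1 - μ) / n) = -(μ * (1 - μ) * (k i / n)) := by ring
    rw [h]
    linarith
  have hrr : ∀ i, ∑ j, circMatrix ℓ k i j * d j ≤ (1 - μ) * rowSlack ℓ k b x i := by
    intro i
    have := hz (Arc.revRow i)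
    simp [weight, fwdSum, revSum, windingSum, Arc.head, Arc.tail, Arc.len, fwdSlack,
      revSlack, neg_div] at this
    rw [hdrow, hc]
    have h : (k i : ℝ) * -(μ * (1 - μ) / n) = -(μ * (1 - μ) * (k i / n)) := by ring
    rw [h]
    linarith
  have hlin : ∀ (t : ℝ) (i : Fin m), ∑ j, circMatrix ℓ k i j * (x j + t * d j) =
      rowSlack ℓ k b x i + b i + t * ∑ j, circMatrix ℓ k i j * d j := by
    intro t i
    rw [rowSlack, sub_add_cancel, Finset.mul_sum, ← Finset.sum_add_distrib]
    exact Finset.sum_congr rfl fun j _ => by ring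
  have hlin' : ∀ t : ℝ, ∑ j, (x j + t * d j) = β + 1 - μ - t * (μ * (1 - μ)) := by
    intro t
    rw [Finset.sum_add_distrib, ← Finset.mul_sum, hsum, hβ]
    ring
  refine ⟨fun j => x j + μ⁻¹ * d j, ⟨fun j => ?_, fun i => ?_⟩,
    fun j => x j + -(1 - μ)⁻¹ * d j, ⟨fun j => ?_, fun i => ?_⟩, ?_, ?_, ?_⟩
  · have := mul_le_mul_of_nonneg_left (hfs j) (inv_nonneg.2 hμ0.le)
    rw [← neg_mul_eq_mul_neg, inv_mul_cancel_left₀ hμ0.ne'] at this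
    linarith
  · have := mul_le_mul_of_nonneg_left (hfr i) (inv_nonneg.2 hμ0.le)
    rw [← neg_mul_eq_mul_neg, inv_mul_cancel_left₀ hμ0.ne'] at this
    rw [hlin]
    linarith
  · have := mul_le_mul_of_nonneg_left (hrs j) (inv_nonneg.2 hμ1'.le)
    rw [inv_mul_cancel_left₀ hμ1'.ne'] at this
    linarith
  · have := mul_le_mul_of_nonneg_left (hrr i) (inv_nonneg.2 hμ1'.le)
    rw [inv_mul_cancel_left₀ hμ1'.ne'] at this
    rw [hlin]
    linarith
  · rw [hlin', inv_mul_cancel_left₀ hμ0.ne']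
    ring
  · rw [hlin']
    field_simp
    ring
  · funext j
    simp only [Pi.add_apply, Pi.smul_apply, smul_eq_mul]
    field_simp
    ring

end Weights

/-- For a circular matrix `A` without dominating rows and `α ∈ ℕ`,
`Q*(A, α·1)` is completely described by `x ≥ 0`, `A x ≥ α·1` and the `Γ`-inequalities
over all simple directed circuits `Γ` of `D(A)` without reverse row arcs, with
`p(Γ) ≥ 2` and `p(Γ)` not dividing `t(Γ, α·1)`. -/
theorem Qstar_homogeneous_description {m n : ℕ} [NeZero n] (ℓ : Fin m → ZMod n)
    (k : Fin m → ℕ) (hA : circBounds n k)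
    (hdom : NoDominatingRows (circMatrix ℓ k)) (α : ℕ) :
    Qstar (circMatrix ℓ k) (fun _ => (α : ℝ)) =
      {x | x ∈ Qpoly (circMatrix ℓ k) (fun _ => (α : ℝ)) ∧
        ∀ (γ : List (Arc m n)) (p : ℤ), IsCircuit ℓ k γ →
          (∀ a ∈ γ, ¬ Arc.IsRevRow a) →
          p * (n : ℤ) = windingSum k γ → 2 ≤ p →
          ¬ (p ∣ tVal (fun _ => (α : ℤ)) γ) →
          GammaIneqHolds ℓ k (fun _ => (α : ℤ)) γ p x} := by
  have hk : ∀ i, k i ≤ n := fun i => (hA i).2.trans (Nat.sub_le n 1)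
  have hcast : (fun _ : Fin m => (α : ℝ)) = fun _ => (((α : ℕ) : ℤ) : ℝ) := by simp
  rw [hcast]
  refine Set.Subset.antisymm ?_ ?_
  · intro x hx
    refine ⟨convexHull_min (fun z hz => hz.2) (convex_Qpoly _ _) hx, ?_⟩
    intro γ p hγ hrev hp hp2 _
    exact convexHull_min
      (fun z hz => gammaIneqHolds_of_isIntegerPoint hk hz.1 hz.2 hγ.1 hrev hp (by omega))
      (convex_setOf_gammaIneqHolds ℓ k (fun _ => (α : ℤ)) γ p) hx
  · rintro x ⟨hx, hΓ⟩
    by_cases hintegral : ∑ j, x j = (⌊∑ j, x j⌋ : ℝ)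
    · exact Qpoly_slice_subset_Qstar ℓ k hk (fun _ => (α : ℤ)) x hx _ hintegral
    set β : ℤ := ⌊∑ j, x j⌋ with hβdef
    have hμ0 : 0 < (β : ℝ) + 1 - ∑ j, x j := sub_pos.2 (Int.lt_floor_add_one _)
    have hμ1 : (β : ℝ) + 1 - ∑ j, x j < 1 := by
      have := lt_of_le_of_ne (Int.floor_le (∑ j, x j)) (Ne.symm hintegral)
      linarith
    set μ : ℝ := (β : ℝ) + 1 - ∑ j, x j with hμ
    have hβ : ∑ j, x j = β + 1 - μ := by rw [hμ]; ring
    have hcirc := weight_nonneg_of_circuits (b := fun _ => (α : ℤ)) (x := x) μ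
      (fun γ hγ hrev => by
        obtain ⟨-, u, hw⟩ := (isClosedWalk_iff ℓ k γ).1 hγ.1
        exact weight_nonneg_of_gammaIneqHolds hk hx hμ0 hμ1 hβ hw hrev
          fun p hp hp2 hdvd => hΓ γ p hγ hrev hp hp2 hdvd)
    have hall := weight_nonneg_of_no_revRow hk hdom (Int.natCast_nonneg α) hx hμ0 hμ1 hβ hcirc
    obtain ⟨x₁, hx₁, x₂, hx₂, hs₁, hs₂, hcomb⟩ :=
      exists_slice_decomposition (b := fun _ => (α : ℤ)) hk hx hμ0 hμ1 hβ hall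
    rw [← hcomb]
    exact convex_convexHull ℝ _
      (Qpoly_slice_subset_Qstar ℓ k hk (fun _ => (α : ℤ)) x₁ hx₁ β hs₁)
      (Qpoly_slice_subset_Qstar ℓ k hk (fun _ => (α : ℤ)) x₂ hx₂ (β + 1) (by exact_mod_cast hs₂))
      hμ0.le (sub_nonneg.2 hμ1.le) (by ring)

end CircCover
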